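/- Suppose x₀ > 0 and x₁ > 0. Then limsup_{n→∞} (E(n))^{1/n} ≤ 1.2338, where E(n) = S(n)/2ⁿ is the expected absolute value of the n-th term of a random Fibonacci sequence with equiprobable independent signs. (This is the upper half of the paper's Theorem 1, which asserts the bound 1.23375.) -/

import Mathlib

open Filter

/-- The random Fibonacci sequence determined by initial values `x0, x1` and the
sign sequence `ε : Fin n → Bool` (`true` ↦ `+1`, `false` ↦ `-1`):
`x 0 = x0`, `x 1 = x1`, `x (k+2) = (±1) * x (k+1) + x k` where the sign is `ε k`. -/
noncomputable def randFib (x0 x1 : ℝ) {n : ℕ} (ε : Fin n → Bool) : ℕ → ℝ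
  | 0 => x0
  | 1 => x1
  | k + 2 =>
      (if h : k < n then (if ε ⟨k, h⟩ then (1 : ℝ) else -1) else 1) *
        randFib x0 x1 ε (k + 1) + randFib x0 x1 ε k

/-- `rowSum x0 x1 n` is the sum of the absolute values of the `n`-th row of the tree
of all `2^n` random Fibonacci sequences with initial values `x0, x1`. -/
noncomputable def rowSum (x0 x1 : ℝ) (n : ℕ) : ℝ :=
  ∑ ε : Fin n → Bool, |randFib x0 x1 ε (n + 1)|

/-- `expAbs x0 x1 n = rowSum x0 x1 n / 2 ^ n` is the expected absolute value of the
`n`-th term of a random Fibonacci sequence with equiprobable independent signs. -/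
noncomputable def expAbs (x0 x1 : ℝ) (n : ℕ) : ℝ := rowSum x0 x1 n / 2 ^ n

/-- Prepending a sign shifts the random Fibonacci sequence by one term. -/
theorem randFib_cons (x0 x1 : ℝ) {n : ℕ} (b : Bool) (ε : Fin n → Bool) (k : ℕ) :
    randFib x0 x1 (Fin.cons b ε : Fin (n + 1) → Bool) (k + 1) =
      randFib x1 ((if b then (1 : ℝ) else -1) * x1 + x0) ε k := by
  induction k using Nat.twoStepInduction with
  | zero => simp [randFib]
  | one => simp [randFib]
  | more k ih0 ih1 =>
    rw [randFib, ih1, ih0, randFib]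
    congr 2
    by_cases h : k < n
    · have hs : (⟨k + 1, Nat.succ_lt_succ h⟩ : Fin (n + 1)) = Fin.succ ⟨k, h⟩ := rfl
      simp only [h, Nat.add_lt_add_iff_right, dite_true, hs, Fin.cons_succ]
    · simp [h]

theorem rowSum_zero (x0 x1 : ℝ) : rowSum x0 x1 0 = |x1| := by
  simp [rowSum, randFib]

theorem rowSum_succ (x0 x1 : ℝ) (n : ℕ) :
    rowSum x0 x1 (n + 1) = rowSum x1 (x1 + x0) n + rowSum x1 (-x1 + x0) n := by
  have h := (Fin.consEquiv fun _ : Fin (n + 1) => Bool).sum_comp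
    fun ε => |randFib x0 x1 ε (n + 1 + 1)|
  rw [rowSum, ← h, Fintype.sum_prod_type]
  simp [Fin.consEquiv, randFib_cons, rowSum]

/-- A norm on pairs of consecutive terms that grows on average by a factor of at most `1.2338`
in each step of the random Fibonacci recursion. -/
noncomputable def pairNorm (a b : ℝ) : ℝ :=
  1.8103 * |a| + 2.4673 * |b| + |(|a| - |b|)|

theorem abs_le_pairNorm (a b : ℝ) : |b| ≤ pairNorm a b := by
  unfold pairNorm
  linarith [abs_nonneg a, abs_nonneg b, abs_nonneg (|a| - |b|)]

theorem pairNorm_step (a b : ℝ) :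
    pairNorm b (b + a) + pairNorm b (-b + a) ≤ 2 * 1.2338 * pairNorm a b := by
  unfold pairNorm
  rcases abs_cases a with ⟨h1, h1'⟩ | ⟨h1, h1'⟩ <;>
  rcases abs_cases b with ⟨h2, h2'⟩ | ⟨h2, h2'⟩ <;>
  rcases abs_cases (b + a) with ⟨h3, h3'⟩ | ⟨h3, h3'⟩ <;>
  rcases abs_cases (-b + a) with ⟨h4, h4'⟩ | ⟨h4, h4'⟩ <;>
  rcases abs_cases (|a| - |b|) with ⟨h5, h5'⟩ | ⟨h5, h5'⟩ <;>
  rcases abs_cases (|b| - |b + a|) with ⟨h6, h6'⟩ | ⟨h6, h6'⟩ <;>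
  rcases abs_cases (|b| - |-b + a|) with ⟨h7, h7'⟩ | ⟨h7, h7'⟩ <;>
  linarith

theorem rowSum_le (x0 x1 : ℝ) (n : ℕ) :
    rowSum x0 x1 n ≤ (2 * 1.2338) ^ n * pairNorm x0 x1 := by
  induction n generalizing x0 x1 with
  | zero => simpa [rowSum_zero] using abs_le_pairNorm x0 x1
  | succ n ih =>
    calc rowSum x0 x1 (n + 1)
        ≤ (2 * 1.2338) ^ n * (pairNorm x1 (x1 + x0) + pairNorm x1 (-x1 + x0)) := by
          rw [rowSum_succ, mul_add]
          exact add_le_add (ih _ _) (ih _ _)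
      _ ≤ (2 * 1.2338) ^ n * (2 * 1.2338 * pairNorm x0 x1) := by
          gcongr
          exact pairNorm_step x0 x1
      _ = (2 * 1.2338) ^ (n + 1) * pairNorm x0 x1 := by ring

theorem expAbs_nonneg (x0 x1 : ℝ) (n : ℕ) : 0 ≤ expAbs x0 x1 n := by
  unfold expAbs rowSum
  positivity

theorem expAbs_le (x0 x1 : ℝ) (n : ℕ) : expAbs x0 x1 n ≤ 1.2338 ^ n * pairNorm x0 x1 := by
  rw [expAbs, div_le_iff₀ (by positivity)]
  calc rowSum x0 x1 n ≤ (2 * 1.2338) ^ n * pairNorm x0 x1 := rowSum_le x0 x1 n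
    _ = 1.2338 ^ n * pairNorm x0 x1 * 2 ^ n := by rw [mul_pow]; ring

theorem expAbs_limsup_upper (x0 x1 : ℝ) (hx0 : 0 < x0) (hx1 : 0 < x1) :
    limsup (fun n : ℕ => expAbs x0 x1 n ^ ((n : ℝ)⁻¹)) atTop ≤ (1.2338 : ℝ) := by
  have hC : 0 < pairNorm x0 x1 := (abs_pos.2 hx1.ne').trans_le (abs_le_pairNorm x0 x1)
  have hlim : Tendsto (fun n : ℕ => (1.2338 : ℝ) * pairNorm x0 x1 ^ ((n : ℝ)⁻¹)) atTop
      (nhds 1.2338) := by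
    have h := ((Real.continuousAt_const_rpow (b := 0) hC.ne').tendsto.comp
      (tendsto_inv_atTop_nhds_zero_nat (𝕜 := ℝ))).const_mul (1.2338 : ℝ)
    simpa using h
  rw [← hlim.limsup_eq]
  refine limsup_le_limsup ?_ ?_ hlim.isBoundedUnder_le
  · filter_upwards [eventually_ne_atTop 0] with n hn
    calc expAbs x0 x1 n ^ ((n : ℝ)⁻¹)
        ≤ (1.2338 ^ n * pairNorm x0 x1) ^ ((n : ℝ)⁻¹) :=
          Real.rpow_le_rpow (expAbs_nonneg x0 x1 n) (expAbs_le x0 x1 n) (by positivity)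
      _ = 1.2338 * pairNorm x0 x1 ^ ((n : ℝ)⁻¹) := by
          rw [Real.mul_rpow (by positivity) hC.le, Real.pow_rpow_inv_natCast (by norm_num) hn]
  · exact IsCoboundedUnder.of_frequently_ge
      (Frequently.of_forall fun n => Real.rpow_nonneg (expAbs_nonneg x0 x1 n) _)
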